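/- arXiv:2406.04078 — 3 statements merged into one kernel-verified Lean document; each statement's English description precedes it below -/
import Mathlib

section
/- Fix integers d ≥ 2 and n ≥ 1, and set M = (n+2)(d−1), N = (n+1)(d−1)+1, M̄ = (n+1)(d−1), and N̄ = n(d−1)+1. The following are equivalent: (a) 2^ℵ₀ ≤ ℵ_n; (b) for all well-placed points c₁, …, c_N ∈ ℝ^d there are sets X₁, …, X_N covering ℝ^d such that each X_i is a spray with center c_i; (c) there exist well-placed points c₁, …, c_M ∈ ℝ^d and sets X₁, …, X_M covering ℝ^d such that each X_i is a spray with center c_i; (d) for all well-placed points c₁, …, c_N̄ ∈ ℝ^d there are sets X₁, …, X_N̄ covering ℝ^d such that each X_i is a σ-spray with center c_i; (e) there exist well-placed points c₁, …, c_M̄ ∈ ℝ^d and sets X₁, …, X_M̄ covering ℝ^d such that each X_i is a σ-spray with center c_i. -/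
open Cardinal

/-- A spray with center `c`: every sphere centered at `c` meets `X` in a finite set. -/
def IsSpray {d : ℕ} (c : EuclideanSpace ℝ (Fin d)) (X : Set (EuclideanSpace ℝ (Fin d))) : Prop :=
  ∀ r : ℝ, {x ∈ X | ‖x - c‖ = r}.Finite

/-- A σ-spray with center `c`: every sphere centered at `c` meets `X` in a countable set. -/
def IsSigmaSpray {d : ℕ} (c : EuclideanSpace ℝ (Fin d))
    (X : Set (EuclideanSpace ℝ (Fin d))) : Prop :=
  ∀ r : ℝ, {x ∈ X | ‖x - c‖ = r}.Countable

/-- Points are well-placed: they lie on a common affine hyperplane and every subset of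
size at most `d` is affinely independent. -/
def WellPlaced {d N : ℕ} (c : Fin N → EuclideanSpace ℝ (Fin d)) : Prop :=
  (∃ H : AffineSubspace ℝ (EuclideanSpace ℝ (Fin d)),
      Module.finrank ℝ H.direction = d - 1 ∧ ∀ i, c i ∈ H) ∧
  ∀ s : Finset (Fin N), s.card ≤ d → AffineIndependent ℝ (fun i : s => c i)


theorem aleph_regular (m : ℕ) : (aleph (m : Ordinal.{0})).IsRegular := by
  cases m with
  | zero => simpa using isRegular_aleph0
  | succ m => 
    have := isRegular_aleph_add_one (m : Ordinal.{0})
    push_cast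
    exact this

theorem lt_aleph_succ_iff (c : Cardinal.{0}) (m : ℕ) :
    c < aleph ((m + 1 : ℕ) : Ordinal.{0}) ↔ c ≤ aleph (m : Ordinal.{0}) := by
  push_cast
  rw [← succ_aleph, Order.lt_succ_iff]

set_option linter.unusedSectionVars false

section Upper

variable {E ι : Type} [Fintype ι] (g : ι → E → ℝ) (d : ℕ)

/-- values of any `d` of the functions determine finitely many points -/
def FinDet : Prop := ∀ s : Finset ι, s.card = d → ∀ v : ι → ℝ, {x | ∀ i ∈ s, g i x = v i}.Finite

theorem pts_preimage (s : Finset ι) (C : Set ℝ) :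
    {x | ∀ i ∈ s, g i x ∈ C} = (fun x => fun i : s => g i x) ⁻¹' {f | ∀ i : s, f i ∈ C} := by
  ext x; simp

theorem fiber_finite (h : FinDet g d) (s : Finset ι) (hs : s.card = d) (f : s → ℝ) :
    ((fun x => fun i : s => g i x) ⁻¹' {f}).Finite := by
  classical
  refine (h s hs (fun i => if hi : i ∈ s then f ⟨i, hi⟩ else 0)).subset ?_
  intro x hx i hi
  have : (fun i : s => g i x) = f := hx
  simp only [hi, dif_pos]
  exact congrFun this ⟨i, hi⟩

theorem pts_finite (h : FinDet g d) (s : Finset ι) (hs : s.card = d) (C : Set ℝ) (hC : C.Finite) :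
    {x | ∀ i ∈ s, g i x ∈ C}.Finite := by
  rw [pts_preimage]
  exact (Set.Finite.pi' (fun _ => hC)).preimage' (fun f _ => fiber_finite g d h s hs f)

theorem pts_card (h : FinDet g d) (s : Finset ι) (hs : s.card = d) (C : Set ℝ) (μ : Cardinal.{0})
    (hμ : ℵ₀ ≤ μ) (hC : #C ≤ μ) :
    #{x | ∀ i ∈ s, g i x ∈ C} ≤ μ := by
  rw [pts_preimage]
  set P : Set (s → ℝ) := {f | ∀ i : s, f i ∈ C}
  have h1 : #P ≤ μ := by
    have : #P ≤ #(s → C) := by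
      refine mk_le_of_injective (f := fun p : P => fun i : s => (⟨p.1 i, p.2 i⟩ : C)) ?_
      intro p q hpq
      ext i
      have := congrFun hpq i
      simpa using this
    refine this.trans ?_
    simp only [mk_pi, prod_const, lift_id, mk_fintype]
    exact (power_le_power_right hC).trans (power_nat_le hμ)
  have h2 : (fun x => fun i : s => g i x) ⁻¹' P
      = ⋃ f ∈ P, (fun x => fun i : s => g i x) ⁻¹' {f} := by
    ext x; simp
  rw [h2]
  refine (mk_biUnion_le _ _).trans ?_
  refine (mul_le_mul' h1 (ciSup_le' (a := ℵ₀) fun f => ?_)).trans (mul_le_of_le hμ le_rfl hμ)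
  exact (lt_aleph0_iff_set_finite.2 (fiber_finite g d h s hs f)).le

/-- one step of closing off -/
def clStep (C : Set ℝ) : Set ℝ :=
  C ∪ ⋃ s : {s : Finset ι // s.card = d}, ⋃ i : ι, g i '' {x | ∀ i ∈ s.1, g i x ∈ C}

theorem clStep_mono : Monotone (clStep g d) := by
  intro A B hAB
  unfold clStep
  refine Set.union_subset_union hAB (Set.iUnion_mono fun s => Set.iUnion_mono fun i =>
    Set.image_mono ?_)
  intro x hx i hi
  exact hAB (hx i hi)

theorem clStep_card (h : FinDet g d) (C : Set ℝ) (μ : Cardinal.{0})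
    (hμ : ℵ₀ ≤ μ) (hC : #C ≤ μ) : #(clStep g d C) ≤ μ := by
  unfold clStep
  refine (mk_union_le _ _).trans (add_le_of_le hμ hC ?_)
  refine (mk_iUnion_le _).trans (mul_le_of_le hμ ?_ (ciSup_le' fun s => ?_))
  · exact (lt_aleph0_of_finite _).le.trans hμ
  refine (mk_iUnion_le _).trans (mul_le_of_le hμ ?_ (ciSup_le' fun i => ?_))
  · exact (lt_aleph0_of_finite _).le.trans hμ
  exact mk_image_le.trans (pts_card g d h s.1 s.2 C μ hμ hC)

/-- closure -/
def cl (C : Set ℝ) : Set ℝ := ⋃ k : ℕ, (clStep g d)^[k] C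

theorem subset_cl (C : Set ℝ) : C ⊆ cl g d C :=
  Set.subset_iUnion (fun k : ℕ => (clStep g d)^[k] C) 0

theorem cl_mono {A B : Set ℝ} (h : A ⊆ B) : cl g d A ⊆ cl g d B :=
  Set.iUnion_mono fun k => (clStep_mono g d).iterate k h

theorem cl_card (h : FinDet g d) (C : Set ℝ) (μ : Cardinal.{0})
    (hμ : ℵ₀ ≤ μ) (hC : #C ≤ μ) : #(cl g d C) ≤ μ := by
  unfold cl
  refine (mk_iUnion_le _).trans (mul_le_of_le hμ (by simpa using hμ) (ciSup_le' fun k => ?_))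
  induction k with
  | zero => simpa using hC
  | succ k ih =>
    rw [Function.iterate_succ_apply']
    exact clStep_card g d h _ μ hμ ih

theorem cl_closed (C : Set ℝ) (s : Finset ι) (hs : d ≤ s.card) (x : E)
    (hx : ∀ i ∈ s, g i x ∈ cl g d C) (i : ι) : g i x ∈ cl g d C := by
  obtain ⟨s', hs', hc⟩ := Finset.exists_subset_card_eq hs
  have hmono : Monotone (fun k : ℕ => (clStep g d)^[k] C) := by
    refine monotone_nat_of_le_succ fun k => ?_
    rw [Function.iterate_succ_apply']
    exact Set.subset_union_left
  have : ∀ i : ι, ∃ k : ℕ, i ∈ s' → g i x ∈ (clStep g d)^[k] C := by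
    intro i
    by_cases hi : i ∈ s'
    · obtain ⟨k, hk⟩ := Set.mem_iUnion.1 (hx i (hs' hi))
      exact ⟨k, fun _ => hk⟩
    · exact ⟨0, fun h => absurd h hi⟩
  choose k hk using this
  set K := Finset.univ.sup k
  refine Set.mem_iUnion.2 ⟨K + 1, ?_⟩
  rw [Function.iterate_succ_apply']
  refine Or.inr (Set.mem_iUnion.2 ⟨⟨s', hc⟩, Set.mem_iUnion.2 ⟨i, x, ?_, rfl⟩⟩)
  intro j hj
  exact hmono (Finset.le_sup (Finset.mem_univ j)) (hk j hj)

theorem rank_exists (h : FinDet g d) (hd : 1 ≤ d) [Nonempty ι] (m : ℕ) (W : Set ℝ)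
    (hW : #W ≤ aleph ((m + 1 : ℕ) : Ordinal.{0})) :
    ∃ (T : Type) (ρ : ℝ → T) (C : T → Set ℝ), (∀ t, #(C t) ≤ aleph (m : Ordinal.{0})) ∧
      ∀ x, (∀ i, g i x ∈ W) → ∃ t, (∀ i, g i x ∈ C t) ∧
        ∀ s : Finset ι, (∀ i ∈ s, ρ (g i x) ≠ t) → s.card ≤ d - 1 := by
  classical
  set c := aleph ((m + 1 : ℕ) : Ordinal.{0}) with hc
  let T := c.ord.ToType
  have hT : #T = c := mk_ord_toType c
  have hTne : Nonempty T := by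
    rw [← mk_ne_zero_iff, hT]
    exact (aleph_pos _).ne'
  obtain ⟨f⟩ : Nonempty (W ↪ T) := by
    rw [← Cardinal.le_def, hT]; exact hW
  let A : T → Set ℝ := fun t => {u | ∃ hu : u ∈ W, f ⟨u, hu⟩ ≤ t}
  have hA : ∀ t, #(A t) ≤ aleph (m : Ordinal.{0}) := by
    intro t
    have h1 : #(Set.Iic t) ≤ aleph (m : Ordinal.{0}) := by
      have h2 : #(Set.Iio t) ≤ aleph (m : Ordinal.{0}) :=
        (lt_aleph_succ_iff _ m).1 (by
          have := mk_Iio_lt t (by rw [hT]; simp [T])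
          rwa [hT] at this)
      rw [← Set.Iio_union_right]
      refine (mk_union_le _ _).trans (add_le_of_le (aleph0_le_aleph _) h2 ?_)
      simpa using (one_le_aleph0.trans (aleph0_le_aleph _))
    refine le_trans ?_ h1
    refine mk_le_of_injective (f := fun u : A t => (⟨f ⟨u.1, u.2.1⟩, u.2.2⟩ : Set.Iic t)) ?_
    intro u v huv
    have := f.injective (congrArg Subtype.val huv)
    ext
    simpa using this
  have hAm : ∀ {t t'}, t ≤ t' → A t ⊆ A t' := fun htt u ⟨hu, h⟩ => ⟨hu, h.trans htt⟩
  have hρ : ∀ v : ℝ, ∃ t : T, v ∈ W → v ∈ cl g d (A t) ∧ ∀ t', v ∈ cl g d (A t') → t ≤ t' := by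
    intro v
    by_cases hv : v ∈ W
    · have hne : {t | v ∈ cl g d (A t)}.Nonempty := ⟨f ⟨v, hv⟩, subset_cl g d _ ⟨hv, le_rfl⟩⟩
      refine ⟨wellFounded_lt.min _ hne, fun _ => ⟨wellFounded_lt.min_mem _ hne, fun t' ht' => ?_⟩⟩
      exact not_lt.1 (wellFounded_lt.not_lt_min {t | v ∈ cl g d (A t)} ht')
    · exact ⟨hTne.some, fun h => absurd h hv⟩
  choose ρ hρ using hρ
  refine ⟨T, ρ, fun t => cl g d (A t), fun t => cl_card g d h _ _ (aleph0_le_aleph _) (hA t), ?_⟩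
  intro x hx
  obtain ⟨i0, -, hi0⟩ := Finset.exists_max_image Finset.univ (fun i => ρ (g i x))
    Finset.univ_nonempty
  refine ⟨ρ (g i0 x), fun i => ?_, fun s hs => ?_⟩
  · exact cl_mono g d (hAm (hi0 i (Finset.mem_univ i))) (hρ _ (hx i)).1
  · by_contra hcard
    have hds : d ≤ s.card := by omega
    have hsne : s.Nonempty := Finset.card_pos.1 (by omega)
    obtain ⟨i1, hi1, hmax⟩ := Finset.exists_max_image s (fun i => ρ (g i x)) hsne
    have hlt : ρ (g i1 x) < ρ (g i0 x) := lt_of_le_of_ne (hi0 i1 (Finset.mem_univ _)) (hs i1 hi1)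
    have := cl_closed g d (A (ρ (g i1 x))) s hds x
      (fun i hi => cl_mono g d (hAm (hmax i hi)) (hρ _ (hx i)).1) i0
    exact absurd ((hρ _ (hx i0)).2 _ this) (not_le.2 hlt)

/-- there is a good coloring of the points with all values in `W`, using colors in `I` -/
def GoodCol (κ : Cardinal.{0}) (W : Set ℝ) (I : Finset ι) : Prop :=
  ∃ χ : E → ι, (∀ x, (∀ i, g i x ∈ W) → χ x ∈ I) ∧
    ∀ i r, #{x | (∀ j, g j x ∈ W) ∧ χ x = i ∧ g i x = r} < κ

theorem goodCol_step (h : FinDet g d) (hd : 1 ≤ d) [Nonempty ι] (κ : Cardinal.{0})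
    (hκ : κ.IsRegular) (m e : ℕ)
    (IH : ∀ W : Set ℝ, #W ≤ aleph (m : Ordinal.{0}) → ∀ I : Finset ι, e ≤ I.card → GoodCol g κ W I)
    (W : Set ℝ) (hW : #W ≤ aleph ((m + 1 : ℕ) : Ordinal.{0})) (I : Finset ι)
    (hI : e + (d - 1) ≤ I.card) : GoodCol g κ W I := by
  classical
  obtain ⟨T, ρ, C, hC, hx⟩ := rank_exists g d h hd m W hW
  have IH' : ∀ t : T, ∀ J : {J : Finset ι // e ≤ J.card}, GoodCol g κ (C t) J.1 :=
    fun t J => IH _ (hC t) J.1 J.2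
  choose χ hχ1 hχ2 using IH'
  have key : ∀ x : E, ∃ (i : ι), (∀ i, g i x ∈ W) → i ∈ I ∧ ∃ J : {J : Finset ι // e ≤ J.card},
      (∀ j, g j x ∈ C (ρ (g i x))) ∧ χ (ρ (g i x)) J x = i := by
    intro x
    by_cases hxW : ∀ i, g i x ∈ W
    · obtain ⟨t, ht, hs⟩ := hx x hxW
      let J := I.filter (fun i => ρ (g i x) = t)
      have hJ : e ≤ J.card := by
        have h1 := hs (I.filter (fun i => ¬ ρ (g i x) = t)) (by simp)
        have h2 := Finset.card_filter_add_card_filter_not (s := I) (fun i => ρ (g i x) = t)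
        simp only [J]
        omega
      have hm := hχ1 t ⟨J, hJ⟩ x ht
      have hm' := Finset.mem_filter.1 hm
      refine ⟨χ t ⟨J, hJ⟩ x, fun _ => ⟨hm'.1, ⟨J, hJ⟩, ?_⟩⟩
      rw [hm'.2]
      exact ⟨ht, rfl⟩
    · exact ⟨Classical.arbitrary ι, fun h => absurd h hxW⟩
  choose χ' hχ' using key
  refine ⟨χ', fun x hx => (hχ' x hx).1, fun i r => ?_⟩
  refine lt_of_le_of_lt (mk_le_mk_of_subset (t := ⋃ J : {J : Finset ι // e ≤ J.card},
    {x | (∀ j, g j x ∈ C (ρ r)) ∧ χ (ρ r) J x = i ∧ g i x = r}) ?_) ?_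
  · rintro x ⟨hxW, rfl, rfl⟩
    obtain ⟨-, J, hJ1, hJ2⟩ := hχ' x hxW
    exact Set.mem_iUnion.2 ⟨J, hJ1, hJ2, rfl⟩
  · rw [card_iUnion_lt_iff_forall_of_isRegular hκ
      ((lt_aleph0_of_finite _).trans_le hκ.aleph0_le)]
    intro J
    exact hχ2 (ρ r) J i r

theorem goodCol_all (h : FinDet g d) (hd : 1 ≤ d) [Nonempty ι] (κ : Cardinal.{0})
    (hκ : κ.IsRegular) (e : ℕ)
    (base : ∀ W : Set ℝ, #W ≤ ℵ₀ → ∀ I : Finset ι, e ≤ I.card → GoodCol g κ W I) (m : ℕ) :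
    ∀ W : Set ℝ, #W ≤ aleph (m : Ordinal.{0}) → ∀ I : Finset ι, e + m * (d - 1) ≤ I.card →
      GoodCol g κ W I := by
  induction m with
  | zero => simpa using base
  | succ m ih =>
    intro W hW I hI
    refine goodCol_step g d h hd κ hκ m (e + m * (d - 1)) ih W hW I ?_
    rw [Nat.succ_mul] at hI
    omega

theorem base_sigma (h : FinDet g d) (hι : d ≤ Fintype.card ι) (W : Set ℝ) (hW : #W ≤ ℵ₀)
    (I : Finset ι) (hI : 1 ≤ I.card) : GoodCol g (aleph ((1 : ℕ) : Ordinal.{0})) W I := by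
  obtain ⟨i0, hi0⟩ := Finset.card_pos.1 hI
  obtain ⟨s, -, hs⟩ := Finset.exists_subset_card_eq (s := (Finset.univ : Finset ι)) hι
  refine ⟨fun _ => i0, fun _ _ => hi0, fun i r => ?_⟩
  have := (lt_aleph_succ_iff ℵ₀ 0).2 (by simp)
  refine lt_of_le_of_lt ?_ this
  refine le_trans (mk_le_mk_of_subset ?_) (pts_card g d h s hs W ℵ₀ le_rfl hW)
  rintro x ⟨hx, -⟩ i -
  exact hx i

theorem base_spray (h : FinDet g d) (hd : 1 ≤ d) (W : Set ℝ) (hW : #W ≤ ℵ₀)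
    (I : Finset ι) (hI : d ≤ I.card) : GoodCol g (aleph ((0 : ℕ) : Ordinal.{0})) W I := by
  classical
  obtain ⟨ρ, hρ⟩ := Set.countable_iff_exists_injOn.1 (le_aleph0_iff_set_countable.1 hW)
  have hIne : I.Nonempty := Finset.card_pos.1 (by omega)
  obtain ⟨s, hsI, hs⟩ := Finset.exists_subset_card_eq hI
  have := fun x => Finset.exists_max_image I (fun i => ρ (g i x)) hIne
  choose χ hχ1 hχ2 using this
  refine ⟨χ, fun x _ => hχ1 x, fun i r => ?_⟩
  simp only [Nat.cast_zero, aleph_zero, lt_aleph0_iff_set_finite]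
  have hK : (W ∩ {v | ρ v ≤ ρ r}).Finite := by
    refine Set.Finite.of_finite_image (f := ρ) ?_ (hρ.mono Set.inter_subset_left)
    refine (Set.finite_Iic (ρ r)).subset ?_
    rintro _ ⟨v, hv, rfl⟩
    exact hv.2
  refine (pts_finite g d h s hs _ hK).subset ?_
  rintro x ⟨hx, rfl, rfl⟩ j hj
  exact ⟨hx j, hχ2 x j (hsI hj)⟩

end Upper

theorem kura (δ k : ℕ) (a : ℕ → ℝ) (B : ℕ → Set ℝ) (X : ℕ → Set (ℕ → ℝ))
    (hB : ∀ j, j < k → #(B j) = aleph ((δ + j : ℕ) : Ordinal.{0}))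
    (hcov : ∀ b : ℕ → ℝ, (∀ j, j < k → b j ∈ B j) → (∀ j, k ≤ j → b j = a j) → ∃ j, j < k ∧ b ∈ X j)
    (hX : ∀ j, j < k → ∀ b : ℕ → ℝ, (∀ i, i < j → b i ∈ B i) → (∀ i, j < i → i < k → b i ∈ B i) →
      (∀ i, k ≤ i → b i = a i) →
      #{t ∈ B j | Function.update b j t ∈ X j} < aleph (δ : Ordinal.{0})) : False := by
  induction k generalizing a with
  | zero => 
    obtain ⟨j, hj, -⟩ := hcov a (by simp) (by simp)
    omega
  | succ k ih =>
    set c := aleph ((δ + k : ℕ) : Ordinal.{0}) with hc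
    have hreg : c.IsRegular := aleph_regular _
    let P : Set (ℕ → ℝ) := {b | (∀ j, j < k → b j ∈ B j) ∧ ∀ j, k ≤ j → b j = a j}
    have hP : #P < c := by
      let U : Set ℝ := ⋃ j : Fin k, B j
      have hU : #U < c := by
        rw [card_iUnion_lt_iff_forall_of_isRegular hreg
          ((lt_aleph0_of_finite _).trans_le hreg.aleph0_le)]
        intro j
        rw [hB j (by omega), hc, aleph_lt_aleph]
        exact_mod_cast (by omega : δ + j < δ + k)
      have h1 : #P ≤ #(Fin k → U) := by
        refine mk_le_of_injective (f := fun b : P => fun i : Fin k =>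
          (⟨b.1 i, Set.mem_iUnion.2 ⟨i, b.2.1 i i.2⟩⟩ : U)) ?_
        intro b b' hbb
        ext j
        by_cases hj : j < k
        · have := congrFun hbb ⟨j, hj⟩
          simpa using this
        · rw [b.2.2 j (by omega), b'.2.2 j (by omega)]
      refine h1.trans_lt ?_
      simp only [mk_pi, prod_const, lift_id, mk_fin]
      rcases lt_or_ge (#U) ℵ₀ with h | h
      · exact (power_lt_aleph0 h (natCast_lt_aleph0)).trans_le hreg.aleph0_le
      · exact (power_nat_le h).trans_lt hU
    have hbad : #(⋃ b ∈ P, {t ∈ B k | Function.update b k t ∈ X k}) < c := by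
      rw [card_biUnion_lt_iff_forall_of_isRegular hreg hP]
      intro b hb
      let b' := Function.update b k (a k)
      refine (hX k (by omega) b hb.1 (fun i h1 h2 => by omega)
        (fun i hi => hb.2 i (by omega))).trans_le ?_
      rw [hc, aleph_le_aleph]
      exact_mod_cast (by omega : δ ≤ δ + k)
    obtain ⟨t, htB, ht⟩ : ∃ t ∈ B k, t ∉ ⋃ b ∈ P, {t ∈ B k | Function.update b k t ∈ X k} := by
      by_contra hcon
      push Not at hcon
      have := mk_le_mk_of_subset (show B k ⊆ _ from hcon)
      rw [hB k (by omega)] at this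
      exact absurd this (not_le.2 hbad)
    refine ih (Function.update a k t) (fun j hj => hB j (by omega)) ?_ ?_
    · intro b hb1 hb2
      have hbk : b k = t := by rw [hb2 k le_rfl]; simp
      obtain ⟨j, hj, hbX⟩ := hcov b (fun j hj => by
        rcases Nat.lt_succ_iff_lt_or_eq.1 hj with h | h
        · exact hb1 j h
        · rw [h, hbk]; exact htB) (fun j hj => by
          rw [hb2 j (by omega), Function.update_of_ne (by omega)])
      refine ⟨j, ?_, hbX⟩
      by_contra hjk
      obtain rfl : j = k := by omega
      apply ht
      refine Set.mem_iUnion₂.2 ⟨Function.update b j (a j), ⟨?_, ?_⟩, htB, ?_⟩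
      · intro i hi
        rw [Function.update_of_ne (by omega)]
        exact hb1 i hi
      · intro i hi
        rcases eq_or_ne i j with rfl | h
        · simp
        · rw [Function.update_of_ne h, hb2 i hi, Function.update_of_ne h]
      · rw [Function.update_idem, ← hbk, Function.update_eq_self]
        exact hbX
    · intro j hj b h1 h2 h3
      refine hX j (by omega) b h1 (fun i hi hik => ?_) (fun i hi => ?_)
      · rcases Nat.lt_succ_iff_lt_or_eq.1 hik with h | h
        · exact h2 i hi h
        · rw [h3 i (by omega), h]; simpa using htB
      · rw [h3 i (by omega), Function.update_of_ne (by omega)]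

theorem geo_dist {E : Type} [NormedAddCommGroup E] [InnerProductSpace ℝ E] (u h w : E) (q : ℝ)
    (hu : ‖u‖ = 1) (huh : inner ℝ h u = 0) (huw : inner ℝ w u = 0) (hq : ‖h‖ ^ 2 ≤ q) :
    ‖w + h + Real.sqrt (q - ‖h‖ ^ 2) • u‖ ^ 2 = q + 2 * inner ℝ w h + ‖w‖ ^ 2 := by
  rw [norm_add_sq_real, norm_add_sq_real, inner_add_left, inner_smul_right, inner_smul_right,
    huh, huw, norm_smul, hu, Real.norm_eq_abs, mul_one, sq_abs, Real.sq_sqrt (by linarith)]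
  ring

theorem lower (δ k d m : ℕ) (hd : 2 ≤ d) (hm : m ≤ k * (d - 1))
    (c : Fin m → EuclideanSpace ℝ (Fin d)) (H : AffineSubspace ℝ (EuclideanSpace ℝ (Fin d)))
    (hH : Module.finrank ℝ H.direction = d - 1) (hcH : ∀ i, c i ∈ H)
    (X : Fin m → Set (EuclideanSpace ℝ (Fin d))) (hcov : (⋃ i, X i) = Set.univ)
    (hX : ∀ i r, #{x ∈ X i | ‖x - c i‖ = r} < aleph (δ : Ordinal.{0}))
    (hk : ∀ j, j < k → aleph ((δ + j : ℕ) : Ordinal.{0}) ≤ continuum.{0}) : False := by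
  obtain ⟨i0, -⟩ := Set.mem_iUnion.1 (hcov ▸ Set.mem_univ (0 : EuclideanSpace ℝ (Fin d)))
  set p0 := c i0
  set D := H.direction with hD
  let w : Fin m → D := fun i => ⟨p0 - c i, AffineSubspace.vsub_mem_direction (hcH i0) (hcH i)⟩
  obtain ⟨u, hu1, huD⟩ : ∃ u : EuclideanSpace ℝ (Fin d), ‖u‖ = 1 ∧ ∀ v ∈ D, inner ℝ v u = 0 := by
    have h1 := D.finrank_add_finrank_orthogonal
    rw [hH, finrank_euclideanSpace_fin] at h1
    have : Dᗮ ≠ ⊥ := by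
      intro h
      rw [h, finrank_bot] at h1
      omega
    obtain ⟨u, hu, hu0⟩ := Submodule.exists_mem_ne_zero_of_ne_bot this
    refine ⟨(‖u‖⁻¹ : ℝ) • u, by
      rw [norm_smul, norm_inv, norm_norm, inv_mul_cancel₀ (norm_ne_zero_iff.2 hu0)], fun v hv => ?_⟩
    rw [inner_smul_right, (Submodule.mem_orthogonal D u).1 hu v hv, mul_zero]
  have he : ∀ j : ℕ, ∃ e : ℝ × D, e ≠ 0 ∧ ∀ i : Fin m, (i : ℕ) / (d - 1) = j →
      e.1 + 2 * inner ℝ (w i) e.2 = 0 := by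
    intro j
    let L : (ℝ × D) →ₗ[ℝ] (Fin (d - 1) → ℝ) := LinearMap.pi fun r =>
      if h : j * (d - 1) + r < m then
        LinearMap.fst ℝ ℝ D + (2 : ℝ) • ((innerₗ D (w ⟨_, h⟩)) ∘ₗ LinearMap.snd ℝ ℝ D) else 0
    have hL : LinearMap.ker L ≠ ⊥ := by
      apply LinearMap.ker_ne_bot_of_finrank_lt
      rw [Module.finrank_prod, hH]
      simp
    obtain ⟨e, heL, he0⟩ := Submodule.exists_mem_ne_zero_of_ne_bot hL
    refine ⟨e, he0, fun i hi => ?_⟩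
    have hpos : 0 < d - 1 := by omega
    have h1 := congrFun (LinearMap.mem_ker.1 heL) ⟨i % (d - 1), Nat.mod_lt _ hpos⟩
    have h2 : j * (d - 1) + i % (d - 1) = i := by
      rw [← hi]; exact Nat.div_add_mod' _ _
    have h3 : j * (d - 1) + i % (d - 1) < m := by rw [h2]; exact i.2
    have h4 : (⟨j * (d - 1) + i % (d - 1), h3⟩ : Fin m) = i := Fin.ext h2
    simp only [L, LinearMap.pi_apply, h3, dif_pos, h4] at h1
    simpa using h1
  choose e he0 he using he
  let V : (ℕ → ℝ) → ℝ × D := fun b => (1, 0) + ∑ j ∈ Finset.range k, b j • e j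
  have hVu : ∀ b j t, j < k →
      V (Function.update b j t) = V (Function.update b j 0) + t • e j := by
    intro b j t hj
    have : ∀ i, Function.update b j t i • e i
        = Function.update b j 0 i • e i + (if i = j then t • e j else 0) := by
      intro i
      by_cases h : i = j
      · subst h; simp
      · simp [h]
    simp only [V]
    rw [Finset.sum_congr rfl (fun i _ => this i), Finset.sum_add_distrib, Finset.sum_ite_eq',
      if_pos (Finset.mem_range.2 hj), add_assoc]
  obtain ⟨ε, hε, hreg⟩ : ∃ ε > 0, ∀ b : ℕ → ℝ, (∀ j, j < k → b j ∈ Set.Ioo 0 ε) →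
      ‖(V b).2‖ ^ 2 ≤ (V b).1 := by
    let V' : (Fin k → ℝ) → ℝ × D := fun b => (1, 0) + ∑ j : Fin k, b j • e j
    have hV'c : Continuous V' := by fun_prop
    have hopen : IsOpen {b | ‖(V' b).2‖ ^ 2 < (V' b).1} := by
      apply isOpen_lt <;> fun_prop
    have h0 : (0 : Fin k → ℝ) ∈ {b | ‖(V' b).2‖ ^ 2 < (V' b).1} := by simp [V']
    obtain ⟨ε, hε, hball⟩ := Metric.isOpen_iff.1 hopen 0 h0
    refine ⟨ε, hε, fun b hb => ?_⟩
    have h1 : (fun j : Fin k => b j) ∈ Metric.ball (0 : Fin k → ℝ) ε := by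
      rw [Metric.mem_ball, dist_pi_lt_iff hε]
      intro j
      have := hb j j.2
      simp only [Pi.zero_apply, Real.dist_eq, sub_zero]
      rw [abs_of_pos this.1]
      exact this.2
    have h2 : V b = V' (fun j : Fin k => b j) := by
      simp only [V, V']
      rw [Fin.sum_univ_eq_sum_range (fun j => b j • e j) k]
    rw [h2]
    exact (hball h1).le
  have hBex : ∀ j, ∃ B ⊆ Set.Ioo 0 ε, j < k → #B = aleph ((δ + j : ℕ) : Ordinal.{0}) := by
    intro j
    by_cases hj : j < k
    · have := hk j hj
      rw [← mk_Ioo_real hε] at this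
      obtain ⟨B, hB, hB'⟩ := le_mk_iff_exists_subset.1 this
      exact ⟨B, hB, fun _ => hB'⟩
    · exact ⟨∅, by simp, fun h => absurd h hj⟩
  choose B hBsub hBcard using hBex
  let Φ : ℝ × D → EuclideanSpace ℝ (Fin d) := fun v =>
    p0 + v.2 + Real.sqrt (v.1 - ‖v.2‖ ^ 2) • u
  have hΦdist : ∀ v : ℝ × D, ‖v.2‖ ^ 2 ≤ v.1 → ∀ i,
      ‖Φ v - c i‖ ^ 2 = v.1 + 2 * inner ℝ (w i) v.2 + ‖w i‖ ^ 2 := by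
    intro v hv i
    have h1 : Φ v - c i = (w i : EuclideanSpace ℝ (Fin d)) + v.2
        + Real.sqrt (v.1 - ‖(v.2 : EuclideanSpace ℝ (Fin d))‖ ^ 2) • u := by
      simp only [Φ, w, Submodule.coe_norm]; abel
    rw [h1, geo_dist u _ _ v.1 hu1 (huD _ v.2.2) (huD _ (w i).2) hv]
    simp
  have hΦinj : ∀ v v' : ℝ × D, ‖v.2‖ ^ 2 ≤ v.1 → ‖v'.2‖ ^ 2 ≤ v'.1 → Φ v = Φ v' → v = v' := by
    intro v v' hv hv' h
    have h1 := hΦdist v hv i0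
    have h1' := hΦdist v' hv' i0
    have hw0 : w i0 = 0 := by simp [w, p0]
    rw [h] at h1
    rw [hw0] at h1 h1'
    simp only [inner_zero_left] at h1 h1'
    have hin : ∀ v : ℝ × D, inner ℝ (Φ v - p0) u = Real.sqrt (v.1 - ‖v.2‖ ^ 2) := by
      intro v
      have : Φ v - p0 = v.2 + Real.sqrt (v.1 - ‖v.2‖ ^ 2) • u := by simp only [Φ]; abel
      rw [this, inner_add_left, huD _ v.2.2, inner_smul_left, real_inner_self_eq_norm_sq, hu1]
      simp
    have h2 : Real.sqrt (v.1 - ‖v.2‖ ^ 2) = Real.sqrt (v'.1 - ‖v'.2‖ ^ 2) := by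
      rw [← hin, ← hin, h]
    have h3 : (v.2 : EuclideanSpace ℝ (Fin d)) = v'.2 := by
      have := h
      simp only [Φ, h2] at this
      exact add_left_cancel (add_right_cancel this)
    exact Prod.ext (by linarith) (Subtype.ext h3)
  refine kura δ k 0 B (fun j => {b | ∃ i : Fin m, (i : ℕ) / (d - 1) = j ∧ Φ (V b) ∈ X i})
    hBcard ?_ ?_
  · intro b _ _
    obtain ⟨i, hi⟩ := Set.mem_iUnion.1 (hcov ▸ Set.mem_univ (Φ (V b)))
    refine ⟨i / (d - 1), ?_, i, rfl, hi⟩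
    exact (Nat.div_lt_iff_lt_mul (by omega)).2 (i.2.trans_le hm)
  · intro j hj b hb1 hb2 _
    have hR : ∀ t ∈ B j, ‖(V (Function.update b j t)).2‖ ^ 2 ≤ (V (Function.update b j t)).1 := by
      intro t ht
      refine hreg _ fun i hi => ?_
      rcases lt_trichotomy i j with h | h | h
      · rw [Function.update_of_ne h.ne]; exact hBsub i (hb1 i h)
      · subst h; simpa using hBsub i ht
      · rw [Function.update_of_ne h.ne']; exact hBsub i (hb2 i h hi)
    have hκ := aleph_regular δ
    refine lt_of_le_of_lt (mk_le_mk_of_subset (t := ⋃ i : {i : Fin m // (i : ℕ) / (d - 1) = j},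
      {t ∈ B j | Φ (V (Function.update b j t)) ∈ X i.1}) ?_) ?_
    · rintro t ⟨ht, i, hi, hx⟩
      exact Set.mem_iUnion.2 ⟨⟨i, hi⟩, ht, hx⟩
    rw [card_iUnion_lt_iff_forall_of_isRegular hκ
      ((lt_aleph0_of_finite _).trans_le hκ.aleph0_le)]
    rintro ⟨i, hi⟩
    set v0 := V (Function.update b j 0) with hv0
    set r := Real.sqrt (v0.1 + 2 * inner ℝ (w i) v0.2 + ‖w i‖ ^ 2)
    refine lt_of_le_of_lt ?_ (hX i r)
    have hinj : Set.InjOn (fun t => Φ (V (Function.update b j t)))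
        {t ∈ B j | Φ (V (Function.update b j t)) ∈ X i} := by
      rintro t ⟨ht, -⟩ t' ⟨ht', -⟩ htt
      have h1 := hΦinj _ _ (hR t ht) (hR t' ht') htt
      rw [hVu b j t hj, hVu b j t' hj] at h1
      exact smul_left_injective ℝ (he0 j) (add_left_cancel h1)
    rw [← mk_image_eq_of_injOn _ _ hinj]
    refine mk_le_mk_of_subset ?_
    rintro _ ⟨t, ⟨ht, hx⟩, rfl⟩
    refine ⟨hx, ?_⟩
    have h1 := hΦdist _ (hR t ht) i
    rw [← Real.sqrt_sq (norm_nonneg (Φ (V (Function.update b j t)) - c i)), h1, hVu b j t hj]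
    have h2 := he j i hi
    have h3 : inner ℝ (w i) (t • e j).2 = t * inner ℝ (w i) (e j).2 :=
      real_inner_smul_right (w i) (e j).2 t
    simp only [r, Prod.fst_add, Prod.snd_add, Prod.smul_fst, inner_add_right,
      smul_eq_mul]
    congr 1
    linear_combination t * h2 + 2 * h3


theorem det_finite {d N : ℕ} (hd : 2 ≤ d) (c : Fin N → EuclideanSpace ℝ (Fin d)) (s : Finset (Fin N))
    (hs : s.card = d) (hc : AffineIndependent ℝ (fun i : s => c i)) (v : Fin N → ℝ) :
    {x | ∀ i ∈ s, ‖x - c i‖ = v i}.Finite := by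
  rcases Set.eq_empty_or_nonempty {x | ∀ i ∈ s, ‖x - c i‖ = v i} with h | ⟨x0, hx0⟩
  · rw [h]; exact Set.finite_empty
  obtain ⟨i0, hi0⟩ := Finset.card_pos.1 (by omega : 0 < s.card)
  set D := vectorSpan ℝ (Set.range (fun i : s => c i)) with hD
  have hfin : Module.finrank ℝ D = d - 1 :=
    hc.finrank_vectorSpan (n := d - 1) (by rw [Fintype.card_coe, hs]; omega)
  have h1 := D.finrank_add_finrank_orthogonal
  rw [hfin, finrank_euclideanSpace_fin] at h1
  have h2 : Module.finrank ℝ Dᗮ = 1 := by omega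
  obtain ⟨u, hu0, hu⟩ := finrank_eq_one_iff'.1 h2
  have hline : ∀ x ∈ {x | ∀ i ∈ s, ‖x - c i‖ = v i}, ∃ t : ℝ,
      x = x0 + t • (u : EuclideanSpace ℝ (Fin d)) := by
    intro x hx
    have hmem : x - x0 ∈ Dᗮ := by
      rw [hD, vectorSpan_range_eq_span_range_vsub_left ℝ (fun i : s => c i) ⟨i0, hi0⟩]
      rw [Submodule.mem_orthogonal]
      intro y hy
      induction hy using Submodule.span_induction with
      | mem y hy =>
        obtain ⟨i, rfl⟩ := hy
        have a1 := hx i i.2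
        have a2 := hx i0 hi0
        have a3 := hx0 i i.2
        have a4 := hx0 i0 hi0
        have b1 : ‖x - c i‖ ^ 2 = ‖x0 - c i‖ ^ 2 := by rw [a1, a3]
        have b2 : ‖x - c i0‖ ^ 2 = ‖x0 - c i0‖ ^ 2 := by rw [a2, a4]
        rw [norm_sub_sq_real, norm_sub_sq_real] at b1 b2
        simp only [vsub_eq_sub, inner_sub_left, inner_sub_right]
        rw [real_inner_comm x (c i), real_inner_comm x (c i0), real_inner_comm x0 (c i), real_inner_comm x0 (c i0)]
        linarith
      | zero => simp
      | add y z _ _ hy hz => rw [inner_add_left, hy, hz, add_zero]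
      | smul a y _ hy => rw [inner_smul_left, hy, mul_zero]
    obtain ⟨t, ht⟩ := hu ⟨x - x0, hmem⟩
    refine ⟨t, ?_⟩
    have := congrArg Subtype.val ht
    simp only [Submodule.coe_smul] at this
    rw [this]; abel
  let p : Polynomial ℝ := Polynomial.C (‖(u : EuclideanSpace ℝ (Fin d))‖ ^ 2) * Polynomial.X ^ 2
    + Polynomial.C (2 * inner ℝ (x0 - c i0) (u : EuclideanSpace ℝ (Fin d))) * Polynomial.X
  have hp : p ≠ 0 := by
    intro h
    have := congrArg (fun q => Polynomial.coeff q 2) h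
    simp only [p, Polynomial.coeff_add, Polynomial.coeff_C_mul, Polynomial.coeff_X_pow_self,
      Polynomial.coeff_X_of_ne_one (by norm_num : (2 : ℕ) ≠ 1), Polynomial.coeff_zero] at this
    have h3 : ‖(u : EuclideanSpace ℝ (Fin d))‖ = 0 := by
      apply pow_eq_zero_iff (two_ne_zero) |>.1
      linarith
    exact hu0 (Subtype.ext (norm_eq_zero.1 h3))
  refine ((Polynomial.finite_setOfPred_isRoot hp).image
    (fun t : ℝ => x0 + t • (u : EuclideanSpace ℝ (Fin d)))).subset ?_
  intro x hx
  obtain ⟨t, rfl⟩ := hline x hx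
  refine ⟨t, ?_, rfl⟩
  have a1 := hx i0 hi0
  have a2 := hx0 i0 hi0
  have a3 : ‖(x0 - c i0) + t • (u : EuclideanSpace ℝ (Fin d))‖ ^ 2 = ‖x0 - c i0‖ ^ 2 := by
    rw [a2, ← a1]; congr 2; abel
  rw [norm_add_sq_real, inner_smul_right, norm_smul, mul_pow, Real.norm_eq_abs, sq_abs] at a3
  simp only [Set.mem_ofPred_eq, Polynomial.IsRoot.def, p, Polynomial.eval_add, Polynomial.eval_mul,
    Polynomial.eval_C, Polynomial.eval_pow, Polynomial.eval_X]
  linarith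

/-- moment curve -/
noncomputable def mc (d : ℕ) (k : ℕ) : EuclideanSpace ℝ (Fin d) :=
  WithLp.toLp 2 (fun i : Fin d => (k : ℝ) ^ (i : ℕ))

theorem mc_li (d : ℕ) (t : Finset ℕ) (ht : t.card = d) :
    LinearIndependent ℝ (fun i : t => mc d i) := by
  let f : Fin d → ℝ := fun i => ((t.equivFinOfCardEq ht).symm i : ℕ)
  have hf : Function.Injective f := by
    intro a b hab
    have : (((t.equivFinOfCardEq ht).symm a : t) : ℕ) = ((t.equivFinOfCardEq ht).symm b : t) := by
      exact Nat.cast_injective (R := ℝ) hab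
    exact (t.equivFinOfCardEq ht).symm.injective (Subtype.ext this)
  have h1 : LinearIndependent ℝ (Matrix.vandermonde f).row :=
    Matrix.linearIndependent_rows_of_det_ne_zero (Matrix.det_vandermonde_ne_zero_iff.2 hf)
  rw [← linearIndependent_equiv (t.equivFinOfCardEq ht).symm]
  refine LinearIndependent.of_comp (WithLp.linearEquiv 2 ℝ (Fin d → ℝ)).toLinearMap ?_
  exact h1

theorem mc_ai (d : ℕ) (s : Finset ℕ) (hs : s.card ≤ d) :
    AffineIndependent ℝ (fun i : s => mc d i) := by
  obtain ⟨t, hst, ht⟩ := Infinite.exists_superset_card_eq s d hs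
  have := (mc_li d t ht).affineIndependent ℝ
  exact this.comp_embedding ⟨fun i : s => (⟨i.1, hst i.2⟩ : t), fun a b h =>
    Subtype.ext (congrArg (fun z : t => (z : ℕ)) h)⟩

theorem exists_wellPlaced (d N : ℕ) (hd : 2 ≤ d) :
    ∃ c : Fin N → EuclideanSpace ℝ (Fin d), WellPlaced c := by
  classical
  refine ⟨fun i => mc d i, ⟨?_, ?_⟩⟩
  · let φ : EuclideanSpace ℝ (Fin d) →ₗ[ℝ] ℝ :=
      (EuclideanSpace.proj (𝕜 := ℝ) (⟨0, by omega⟩ : Fin d)).toLinearMap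
    refine ⟨AffineSubspace.mk' (mc d 0) (LinearMap.ker φ), ?_, ?_⟩
    · rw [AffineSubspace.direction_mk']
      have h1 := φ.finrank_range_add_finrank_ker
      have h2 : LinearMap.range φ = ⊤ := by
        rw [LinearMap.range_eq_top]
        intro r
        exact ⟨EuclideanSpace.single ⟨0, by omega⟩ r, by simp [φ]⟩
      rw [h2, finrank_top, finrank_euclideanSpace_fin, Module.finrank_self] at h1
      omega
    · intro i
      rw [AffineSubspace.mem_mk', LinearMap.mem_ker]
      simp [φ, mc]
  · intro s hs
    have := mc_ai d (s.image (fun i : Fin N => (i : ℕ))) (Finset.card_image_le.trans hs)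
    let φ : s ↪ (s.image (fun i : Fin N => (i : ℕ)) : Finset ℕ) :=
      ⟨fun i : s => ⟨i.1.1, Finset.mem_image_of_mem (fun i : Fin N => (i : ℕ)) i.2⟩, fun a b h =>
        Subtype.ext (Fin.ext (congrArg Subtype.val h))⟩
    exact this.comp_embedding φ

theorem isSpray_iff {d : ℕ} (c : EuclideanSpace ℝ (Fin d)) (X : Set (EuclideanSpace ℝ (Fin d))) :
    IsSpray c X ↔ ∀ r : ℝ, #{x ∈ X | ‖x - c‖ = r} < aleph ((0 : ℕ) : Ordinal.{0}) := by
  unfold IsSpray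
  simp only [Nat.cast_zero, aleph_zero, lt_aleph0_iff_set_finite]

theorem isSigmaSpray_iff {d : ℕ} (c : EuclideanSpace ℝ (Fin d))
    (X : Set (EuclideanSpace ℝ (Fin d))) :
    IsSigmaSpray c X ↔ ∀ r : ℝ, #{x ∈ X | ‖x - c‖ = r} < aleph ((1 : ℕ) : Ordinal.{0}) := by
  unfold IsSigmaSpray
  refine forall_congr' fun r => ?_
  rw [show (1 : ℕ) = 0 + 1 from rfl, lt_aleph_succ_iff, Nat.cast_zero, aleph_zero,
    le_aleph0_iff_set_countable]

theorem finDet_of_wellPlaced {d N : ℕ} (hd : 2 ≤ d) (c : Fin N → EuclideanSpace ℝ (Fin d))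
    (hc : WellPlaced c) : FinDet (fun i x => ‖x - c i‖) d :=
  fun s hs v => det_finite hd c s hs (hc.2 s hs.le) v

theorem cover_of_goodCol {d N : ℕ} (c : Fin N → EuclideanSpace ℝ (Fin d)) (κ : Cardinal.{0})
    (h : GoodCol (fun i x => ‖x - c i‖) κ Set.univ Finset.univ) :
    ∃ X : Fin N → Set (EuclideanSpace ℝ (Fin d)),
      (⋃ i, X i) = Set.univ ∧ ∀ i, ∀ r : ℝ, #{x ∈ X i | ‖x - c i‖ = r} < κ := by
  obtain ⟨χ, -, hχ⟩ := h
  refine ⟨fun i => {x | χ x = i}, ?_, fun i r => ?_⟩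
  · ext x; simp
  · refine lt_of_le_of_lt (mk_le_mk_of_subset ?_) (hχ i r)
    rintro x ⟨h1, h2⟩
    exact ⟨fun _ => Set.mem_univ _, h1, h2⟩

theorem upper_spray' (d n N : ℕ) (hd : 2 ≤ d) (hN : (n + 1) * (d - 1) + 1 ≤ N) (hA : continuum.{0} ≤ aleph (n : Ordinal.{0}))
    (c : Fin N → EuclideanSpace ℝ (Fin d)) (hc : WellPlaced c) :
    ∃ X : Fin N → Set (EuclideanSpace ℝ (Fin d)),
      (⋃ i, X i) = Set.univ ∧ ∀ i, IsSpray (c i) (X i) := by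
  simp only [isSpray_iff]
  apply cover_of_goodCol
  have hF := finDet_of_wellPlaced hd c hc
  have : Nonempty (Fin N) := ⟨⟨0, by omega⟩⟩
  refine goodCol_all _ d hF (by omega) _ (aleph_regular 0) d
    (fun W hW I hI => base_spray _ d hF (by omega) W hW I hI) n _ ?_ _ ?_
  · rw [mk_univ, mk_real]; exact hA
  · rw [Finset.card_univ, Fintype.card_fin]
    rw [Nat.succ_mul] at hN
    omega

theorem upper_sigma' (d n N : ℕ) (hd : 2 ≤ d) (hn : 1 ≤ n) (hN : n * (d - 1) + 1 ≤ N)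
    (hA : continuum.{0} ≤ aleph (n : Ordinal.{0}))
    (c : Fin N → EuclideanSpace ℝ (Fin d)) (hc : WellPlaced c) :
    ∃ X : Fin N → Set (EuclideanSpace ℝ (Fin d)),
      (⋃ i, X i) = Set.univ ∧ ∀ i, IsSigmaSpray (c i) (X i) := by
  simp only [isSigmaSpray_iff]
  apply cover_of_goodCol
  have hF := finDet_of_wellPlaced hd c hc
  have hcard : d ≤ Fintype.card (Fin N) := by
    rw [Fintype.card_fin]
    have := Nat.le_mul_of_pos_left (d - 1) hn
    omega
  have : Nonempty (Fin N) := ⟨⟨0, by omega⟩⟩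
  refine goodCol_all _ d hF (by omega) _ (aleph_regular 1) 1
    (fun W hW I hI => base_sigma _ d hF hcard W hW I hI) n _ ?_ _ ?_
  · rw [mk_univ, mk_real]; exact hA
  · rw [Finset.card_univ, Fintype.card_fin]
    omega

theorem lower_all (δ k d m n : ℕ) (hd : 2 ≤ d) (hm : m ≤ k * (d - 1)) (hk : δ + k ≤ n + 2)
    (c : Fin m → EuclideanSpace ℝ (Fin d)) (hc : WellPlaced c)
    (X : Fin m → Set (EuclideanSpace ℝ (Fin d))) (hcov : (⋃ i, X i) = Set.univ)
    (hX : ∀ i, ∀ r : ℝ, #{x ∈ X i | ‖x - c i‖ = r} < aleph (δ : Ordinal.{0})) :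
    continuum.{0} ≤ aleph (n : Ordinal.{0}) := by
  by_contra hcon
  rw [← lt_aleph_succ_iff, not_lt] at hcon
  obtain ⟨⟨H, hH, hcH⟩, -⟩ := hc
  refine lower δ k d m hd hm c H hH hcH X hcov hX fun j hj => le_trans ?_ hcon
  rw [aleph_le_aleph]
  exact_mod_cast (by omega : δ + j ≤ n + 1)

theorem continuum_univ.{u} (n : ℕ) :
    continuum.{u} ≤ aleph (n : Ordinal.{u}) ↔ continuum.{0} ≤ aleph (n : Ordinal.{0}) := by
  rw [← lift_continuum.{u, 0}, ← lift_le.{u} (b := aleph (n : Ordinal.{0})), lift_aleph]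
  simp

theorem le_bound (d k : ℕ) (hd : 2 ≤ d) : k * (d - 1) + 1 ≤ (k + 1) * (d - 1) := by
  rw [Nat.succ_mul]; omega

theorem stmt0 (d n : ℕ) (hd : 2 ≤ d) (hn : 1 ≤ n) :
    ((continuum ≤ aleph n ↔
      (∀ c : Fin ((n + 1) * (d - 1) + 1) → EuclideanSpace ℝ (Fin d),
        WellPlaced c →
        ∃ X : Fin ((n + 1) * (d - 1) + 1) → Set (EuclideanSpace ℝ (Fin d)),
          (⋃ i, X i) = Set.univ ∧ ∀ i, IsSpray (c i) (X i))) ∧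
     (continuum ≤ aleph n ↔
      (∃ c : Fin ((n + 2) * (d - 1)) → EuclideanSpace ℝ (Fin d),
        WellPlaced c ∧
        ∃ X : Fin ((n + 2) * (d - 1)) → Set (EuclideanSpace ℝ (Fin d)),
          (⋃ i, X i) = Set.univ ∧ ∀ i, IsSpray (c i) (X i))) ∧
     (continuum ≤ aleph n ↔
      (∀ c : Fin (n * (d - 1) + 1) → EuclideanSpace ℝ (Fin d),
        WellPlaced c →
        ∃ X : Fin (n * (d - 1) + 1) → Set (EuclideanSpace ℝ (Fin d)),
          (⋃ i, X i) = Set.univ ∧ ∀ i, IsSigmaSpray (c i) (X i))) ∧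
     (continuum ≤ aleph n ↔
      (∃ c : Fin ((n + 1) * (d - 1)) → EuclideanSpace ℝ (Fin d),
        WellPlaced c ∧
        ∃ X : Fin ((n + 1) * (d - 1)) → Set (EuclideanSpace ℝ (Fin d)),
          (⋃ i, X i) = Set.univ ∧ ∀ i, IsSigmaSpray (c i) (X i)))) := by
  simp only [continuum_univ]
  refine ⟨⟨fun h c hc => upper_spray' d n _ hd le_rfl h c hc, fun h => ?_⟩, ⟨fun h => ?_, ?_⟩,
    ⟨fun h c hc => upper_sigma' d n _ hd hn le_rfl h c hc, fun h => ?_⟩, ⟨fun h => ?_, ?_⟩⟩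
  · obtain ⟨c, hc⟩ := exists_wellPlaced d ((n + 1) * (d - 1) + 1) hd
    obtain ⟨X, hcov, hX⟩ := h c hc
    exact lower_all 0 (n + 2) d _ n hd (le_bound d (n + 1) hd) (by omega) c hc X hcov
      (fun i => (isSpray_iff _ _).1 (hX i))
  · obtain ⟨c, hc⟩ := exists_wellPlaced d ((n + 2) * (d - 1)) hd
    refine ⟨c, hc, ?_⟩
    exact upper_spray' d n _ hd (le_bound d (n + 1) hd) h c hc
  · rintro ⟨c, hc, X, hcov, hX⟩
    exact lower_all 0 (n + 2) d _ n hd le_rfl (by omega) c hc X hcov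
      (fun i => (isSpray_iff _ _).1 (hX i))
  · obtain ⟨c, hc⟩ := exists_wellPlaced d (n * (d - 1) + 1) hd
    obtain ⟨X, hcov, hX⟩ := h c hc
    exact lower_all 1 (n + 1) d _ n hd (le_bound d n hd) (by omega) c hc X hcov
      (fun i => (isSigmaSpray_iff _ _).1 (hX i))
  · obtain ⟨c, hc⟩ := exists_wellPlaced d ((n + 1) * (d - 1)) hd
    refine ⟨c, hc, ?_⟩
    exact upper_sigma' d n _ hd hn (le_bound d n hd) h c hc
  · rintro ⟨c, hc, X, hcov, hX⟩
    exact lower_all 1 (n + 1) d _ n hd le_rfl (by omega) c hc X hcov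
      (fun i => (isSigmaSpray_iff _ _).1 (hX i))
end

section
/- Let d ≥ 2, n ≥ 0, and δ ∈ {0, 1}. Assume c₁, …, c_{(n+1)(d−1)+1} are well-placed points in ℝ^d. If 2^ℵ₀ ≤ ℵ_{δ+n}, then there are sets X₁, …, X_{(n+1)(d−1)+1} covering ℝ^d such that each X_i is an ℵ_δ-spray with center c_i. -/
open Cardinal

/-- An ℵ_δ-spray with center `c`: every sphere centered at `c` meets `X` in a set of
cardinality less than `ℵ_δ`. -/
def IsAlephSpray {d : ℕ} (δ : Ordinal) (c : EuclideanSpace ℝ (Fin d))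
    (X : Set (EuclideanSpace ℝ (Fin d))) : Prop :=
  ∀ r : ℝ, Cardinal.mk {x ∈ X | ‖x - c‖ = r} < aleph δ

theorem mk_finset_biUnion_lt {P κι : Type} {κ : Cardinal.{0}} (hκ : ℵ₀ ≤ κ) (s : Finset κι)
    (A : κι → Set P) (hA : ∀ i ∈ s, #(A i) < κ) : #(⋃ i ∈ s, A i : Set P) < κ := by
  classical
  induction s using Finset.induction_on with
  | empty => simpa using lt_of_lt_of_le aleph0_pos hκ
  | insert a s ha ih =>
    rw [Finset.set_biUnion_insert]
    refine lt_of_le_of_lt (mk_union_le _ _) (add_lt_of_lt hκ (hA a (by simp)) (ih ?_))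
    intro i hi
    exact hA i (by simp [hi])

/-- one-step closure -/
def stp {P ι V : Type} (f : ι → P → V) (e : ℕ) (B : Set P) : Set P :=
  {x | ∃ T : Finset ι, T.card = e + 1 ∧ ∀ i ∈ T, ∃ y ∈ B, f i y = f i x}

def FinProp {P ι V : Type} (f : ι → P → V) (e : ℕ) : Prop :=
  ∀ T : Finset ι, T.card = e + 1 → ∀ v : ι → V, {x | ∀ i ∈ T, f i x = v i}.Finite

theorem mk_stp_lt {P ι V : Type} [Fintype ι] (f : ι → P → V) (e : ℕ) (hf : FinProp f e)
    {κ : Cardinal.{0}} (hκ : ℵ₀ ≤ κ) (B : Set P) (hB : #B < κ) : #(stp f e B) < κ := by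
  classical
  have hsub : stp f e B ⊆ ⋃ T ∈ (Finset.univ.filter (fun T : Finset ι => T.card = e + 1)),
      ⋃ y : ι → B, {x | ∀ i ∈ T, f i x = f i (y i)} := by
    rintro x ⟨T, hT, hx⟩
    have hne : T.Nonempty := by
      rw [← Finset.card_pos]; omega
    obtain ⟨i0, hi0⟩ := hne
    obtain ⟨y0, hy0, -⟩ := hx i0 hi0
    simp only [Set.mem_iUnion]
    refine ⟨T, by simp [hT], fun i => if h : i ∈ T then ⟨(hx i h).choose, (hx i h).choose_spec.1⟩
      else ⟨y0, hy0⟩, ?_⟩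
    intro i hi
    simp only [hi, dite_true]
    exact (hx i hi).choose_spec.2.symm
  refine lt_of_le_of_lt (mk_le_mk_of_subset hsub) (mk_finset_biUnion_lt hκ _ _ ?_)
  intro T hT
  have hT' : T.card = e + 1 := by simpa using hT
  have hfin : ∀ y : ι → B, {x | ∀ i ∈ T, f i x = f i (y i)}.Finite := fun y =>
    hf T hT' (fun i => f i (y i))
  by_cases hBf : Finite B
  · have : (⋃ y : ι → B, {x | ∀ i ∈ T, f i x = f i (y i)}).Finite := Set.finite_iUnion hfin
    exact lt_of_lt_of_le (lt_aleph0_iff_set_finite.2 this) hκ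
  · have hBi : ℵ₀ ≤ #B := by
      rw [not_finite_iff_infinite] at hBf
      exact aleph0_le_mk B
    refine lt_of_le_of_lt ?_ hB
    refine (mk_iUnion_le _).trans (mul_le_of_le hBi ?_ ?_)
    · rw [← power_def, mk_fintype ι]
      exact power_nat_le hBi
    · refine ciSup_le' fun y => (lt_aleph0_iff_set_finite.2 (hfin y)).le.trans hBi

/-- iterates of the closure -/
def itr {P ι V : Type} (f : ι → P → V) (e : ℕ) (B : Set P) : ℕ → Set P
  | 0 => B
  | k + 1 => itr f e B k ∪ stp f e (itr f e B k)

def cls {P ι V : Type} (f : ι → P → V) (e : ℕ) (B : Set P) : Set P := ⋃ k, itr f e B k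

theorem itr_mono {P ι V : Type} (f : ι → P → V) (e : ℕ) (B : Set P) : Monotone (itr f e B) :=
  monotone_nat_of_le_succ fun _ => Set.subset_union_left

theorem itr_mono_set {P ι V : Type} (f : ι → P → V) (e : ℕ) {B C : Set P} (h : B ⊆ C) (k : ℕ) :
    itr f e B k ⊆ itr f e C k := by
  induction k with
  | zero => exact h
  | succ k ih =>
    refine Set.union_subset_union ih ?_
    rintro x ⟨T, hT, hx⟩
    exact ⟨T, hT, fun i hi => let ⟨y, hy, h⟩ := hx i hi; ⟨y, ih hy, h⟩⟩

theorem cls_mono {P ι V : Type} (f : ι → P → V) (e : ℕ) {B C : Set P} (h : B ⊆ C) :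
    cls f e B ⊆ cls f e C := Set.iUnion_mono (itr_mono_set f e h)

theorem stp_cls {P ι V : Type} (f : ι → P → V) (e : ℕ) (B : Set P) :
    stp f e (cls f e B) ⊆ cls f e B := by
  classical
  rintro x ⟨T, hT, hx⟩
  have : ∀ i, ∃ k, i ∈ T → ∃ y ∈ itr f e B k, f i y = f i x := by
    intro i
    by_cases hi : i ∈ T
    · obtain ⟨y, hy, h⟩ := hx i hi
      obtain ⟨k, hk⟩ := Set.mem_iUnion.1 hy
      exact ⟨k, fun _ => ⟨y, hk, h⟩⟩
    · exact ⟨0, fun h => absurd h hi⟩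
  choose k hk using this
  refine Set.mem_iUnion.2 ⟨T.sup k + 1, Or.inr ⟨T, hT, fun i hi => ?_⟩⟩
  obtain ⟨y, hy, h⟩ := hk i hi
  exact ⟨y, itr_mono f e B (Finset.le_sup hi) hy, h⟩

theorem mk_cls_le {P ι V : Type} [Fintype ι] (f : ι → P → V) (e : ℕ) (hf : FinProp f e)
    {κ : Cardinal.{0}} (hκ : ℵ₀ ≤ κ) (B : Set P) (hB : #B ≤ κ) : #(cls f e B) ≤ κ := by
  have h : ∀ k, #(itr f e B k) ≤ κ := by
    intro k
    induction k with
    | zero => exact hB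
    | succ k ih =>
      refine (mk_union_le _ _).trans (add_le_of_le hκ ih ?_)
      rw [← Order.lt_succ_iff] at ih ⊢
      exact mk_stp_lt f e hf (hκ.trans (Order.le_succ κ)) _ ih
  refine (mk_iUnion_le _).trans (mul_le_of_le hκ (by simpa using hκ) (ciSup_le' h))

theorem exists_emb {P : Type} {κ : Cardinal.{0}} (hκ : ℵ₀ ≤ κ) (hP : #P ≤ κ) :
    ∃ φ : P → κ.ord.ToType, ∀ w, #{x | φ x ≤ w} < κ := by
  rw [← mk_ord_toType κ] at hP
  obtain ⟨φ⟩ := hP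
  refine ⟨φ, fun w => ?_⟩
  have h1 : #(Set.Iic w) < κ := by
    rw [← Set.Iio_insert]
    refine lt_of_le_of_lt mk_insert_le (add_lt_of_lt hκ ?_ (lt_of_lt_of_le one_lt_aleph0 hκ))
    exact mk_Iio_toType_ord_lt w
  refine lt_of_le_of_lt ?_ h1
  exact mk_le_of_injective (f := fun x : {x | φ x ≤ w} => (⟨φ x.1, x.2⟩ : Set.Iic w))
    (fun a b h => Subtype.ext (φ.injective (congrArg Subtype.val h)))

theorem exists_min_le {P : Type} {W : Type} [LinearOrder W] [WellFoundedLT W] (φ : P → W)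
    (Q : P → W → Prop) (hQ : ∀ x, Q x (φ x)) :
    ∃ r : P → W, (∀ x, Q x (r x)) ∧ ∀ x w, Q x w → r x ≤ w := by
  have : ∀ x, ∃ w, Q x w ∧ ∀ w', Q x w' → w ≤ w' := by
    intro x
    refine ⟨wellFounded_lt.min {w | Q x w} ⟨_, hQ x⟩, wellFounded_lt.min_mem {w | Q x w} _, ?_⟩
    intro w' hw'
    exact not_lt.1 (wellFounded_lt.not_lt_min {w | Q x w} hw')
  choose r hr using this
  exact ⟨r, fun x => (hr x).1, fun x => (hr x).2⟩

theorem spray_base {P ι V : Type} [Fintype ι] (f : ι → P → V) (e : ℕ) (hf : FinProp f e)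
    {κ : Cardinal.{0}} (hκ : ℵ₀ ≤ κ) (hP : #P ≤ κ) (S : Finset ι) (hS : S.card = e + 1) :
    ∃ g : P → ι, (∀ x, g x ∈ S) ∧ ∀ i r, #{x | g x = i ∧ f i x = r} < κ := by
  obtain ⟨φ, hφ⟩ := exists_emb hκ hP
  have : ∀ i, ∃ r : P → κ.ord.ToType, (∀ x, ∃ y, f i y = f i x ∧ φ y = r x) ∧
      ∀ x w, (∃ y, f i y = f i x ∧ φ y = w) → r x ≤ w := fun i =>
    exists_min_le φ (fun x w => ∃ y, f i y = f i x ∧ φ y = w) (fun x => ⟨x, rfl, rfl⟩)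
  choose ρ hρ1 hρ2 using this
  have hne : S.Nonempty := by rw [← Finset.card_pos]; omega
  have : ∀ x, ∃ i ∈ S, ∀ j ∈ S, ρ j x ≤ ρ i x := fun x =>
    Finset.exists_max_image S (fun i => ρ i x) hne
  choose g hg hgm using this
  refine ⟨g, hg, fun i r => ?_⟩
  by_cases hemp : ∃ x0, f i x0 = r
  · obtain ⟨x0, hx0⟩ := hemp
    refine lt_of_le_of_lt (mk_le_mk_of_subset ?_) (mk_stp_lt f e hf hκ _ (hφ (φ x0)))
    rintro x ⟨hgx, hfx⟩
    refine ⟨S, hS, fun j hj => ?_⟩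
    obtain ⟨y, hy1, hy2⟩ := hρ1 j x
    refine ⟨y, ?_, hy1⟩
    have h1 := hgm x j hj
    rw [hgx] at h1
    have h2 := hρ2 i x (φ x0) ⟨x0, by rw [hx0, hfx], rfl⟩
    show φ y ≤ φ x0
    rw [hy2]
    exact h1.trans h2
  · have : {x | g x = i ∧ f i x = r} = ∅ := by
      ext x
      simp only [Set.mem_ofPred_eq, Set.mem_empty_iff_false, iff_false]
      exact fun h => hemp ⟨x, h.2⟩
    rw [this]
    simpa using lt_of_lt_of_le aleph0_pos hκ

theorem spray_main {ι V : Type} [Fintype ι] (e : ℕ) (δ : Ordinal.{0}) (n : ℕ) :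
    ∀ (P : Type) (f : ι → P → V) (_ : FinProp f e) (_ : #P ≤ aleph (δ + n))
      (S : Finset ι) (_ : S.card = (n + 1) * e + 1),
    ∃ g : P → ι, (∀ x, g x ∈ S) ∧ ∀ i r, #{x | g x = i ∧ f i x = r} < aleph δ := by
  classical
  induction n with
  | zero =>
    intro P f hf hP S hS
    exact spray_base f e hf (aleph0_le_aleph δ) (by simpa using hP) S (by simpa using hS)
  | succ n ih =>
    intro P f hf hP S hS
    have hal : aleph (δ + ((n + 1 : ℕ) : Ordinal)) = Order.succ (aleph (δ + n)) := by
      rw [succ_aleph, Nat.cast_succ, add_assoc]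
    obtain ⟨φ, hφ⟩ := exists_emb (aleph0_le_aleph _) hP
    obtain ⟨rk, hrk1, hrk2⟩ := exists_min_le φ (fun x w => x ∈ cls f e {y | φ y ≤ w})
      (fun x => Set.mem_iUnion.2 ⟨0, le_refl (φ x)⟩)
    have hsize : ∀ w, #{x | rk x = w} ≤ aleph (δ + n) := by
      intro w
      refine le_trans (mk_le_mk_of_subset ?_) (mk_cls_le f e hf (aleph0_le_aleph (δ + n))
        {y | φ y ≤ w} (Order.lt_succ_iff.1 (by rw [← hal]; exact hφ w)))
      rintro x rfl
      exact hrk1 x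
    -- few old indices
    have hnew : ∀ x, ∃ T ⊆ S, T.card = (n + 1) * e + 1 ∧
        ∀ i ∈ T, ∀ y, rk y < rk x → f i y ≠ f i x := by
      intro x
      let N := S.filter (fun i => ∀ y, rk y < rk x → f i y ≠ f i x)
      let O := S.filter (fun i => ¬ ∀ y, rk y < rk x → f i y ≠ f i x)
      have hNO : N.card + O.card = S.card := Finset.card_filter_add_card_filter_not _
      have hO : O.card ≤ e := by
        by_contra hcon
        obtain ⟨T, hTO, hT⟩ := Finset.exists_subset_card_eq (Nat.succ_le_of_lt (not_le.1 hcon))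
        have hw : ∀ i ∈ T, ∃ y, rk y < rk x ∧ f i y = f i x := by
          intro i hi
          have := (Finset.mem_filter.1 (hTO hi)).2
          push Not at this
          exact this
        have hTne : T.Nonempty := by rw [← Finset.card_pos]; omega
        haveI : Nonempty P := ⟨x⟩
        choose! y hy1 hy2 using hw
        obtain ⟨i0, hi0, hmax⟩ := Finset.exists_max_image T (fun i => rk (y i)) hTne
        have : x ∈ cls f e {z | φ z ≤ rk (y i0)} := by
          apply stp_cls
          refine ⟨T, hT, fun i hi => ⟨y i, ?_, hy2 i hi⟩⟩
          refine cls_mono f e ?_ (hrk1 (y i))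
          intro z hz
          exact le_trans hz (hmax i hi)
        exact absurd (hrk2 x _ this) (not_le.2 (hy1 i0 hi0))
      have hN : (n + 1) * e + 1 ≤ N.card := by
        have : (n + 1 + 1) * e = (n + 1) * e + e := by ring
        omega
      obtain ⟨T, hTN, hT⟩ := Finset.exists_subset_card_eq hN
      exact ⟨T, hTN.trans (Finset.filter_subset _ _), hT, fun i hi =>
        (Finset.mem_filter.1 (hTN hi)).2⟩
    choose τ hτS hτc hτn using hnew
    have hpiece : ∀ (w) (T : Finset ι), T.card = (n + 1) * e + 1 →
        ∃ g : {x // rk x = w} → ι, (∀ x, g x ∈ T) ∧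
          ∀ i r, #{x : {x // rk x = w} | g x = i ∧ f i x = r} < aleph δ := by
      intro w T hT
      refine ih {x // rk x = w} (fun i x => f i x.1) ?_ (hsize w) T hT
      intro T' hT' v
      exact (hf T' hT' v).preimage Subtype.val_injective.injOn
    choose G hG1 hG2 using hpiece
    refine ⟨fun x => G (rk x) (τ x) (hτc x) ⟨x, rfl⟩, fun x => hτS x (hG1 _ _ _ _), fun i r => ?_⟩
    by_cases hemp : ∃ x0, G (rk x0) (τ x0) (hτc x0) ⟨x0, rfl⟩ = i ∧ f i x0 = r
    · obtain ⟨x0, hx0i, hx0⟩ := hemp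
      have hi0 : i ∈ τ x0 := hx0i ▸ hG1 _ _ _ _
      let A : Finset ι → Set P := fun T => if hT : T.card = (n + 1) * e + 1 then
        Subtype.val '' {x : {x // rk x = rk x0} | G (rk x0) T hT x = i ∧ f i x = r} else ∅
      refine lt_of_le_of_lt (mk_le_mk_of_subset ?_) (mk_finset_biUnion_lt (aleph0_le_aleph δ)
        Finset.univ A ?_)
      · rintro x ⟨hx1, hx2⟩
        have hi : i ∈ τ x := hx1 ▸ hG1 _ _ _ _
        have hrk : rk x = rk x0 := by
          rcases lt_trichotomy (rk x) (rk x0) with h | h | h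
          · exact absurd (hx2.trans hx0.symm) (hτn x0 i hi0 x h)
          · exact h
          · exact absurd (hx0.trans hx2.symm) (hτn x i hi x0 h)
        simp only [Set.mem_iUnion]
        refine ⟨τ x, Finset.mem_univ _, ?_⟩
        simp only [A, hτc x, dite_true]
        refine ⟨⟨x, hrk⟩, ⟨?_, hx2⟩, rfl⟩
        rw [← hx1]
        clear_value A
        clear hx1
        generalize_proofs
        have key : ∀ w (h : rk x = w) (h' : rk x = rk x), G w (τ x) (hτc x) ⟨x, h⟩
            = G (rk x) (τ x) (hτc x) ⟨x, h'⟩ := by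
          intro w h h'
          subst h
          rfl
        exact key _ _ _
      · intro T _
        by_cases hT : T.card = (n + 1) * e + 1
        · simp only [A, hT, dite_true]
          exact lt_of_le_of_lt mk_image_le (hG2 (rk x0) T hT i r)
        · simp only [A, hT, dite_false]
          simpa using lt_of_lt_of_le aleph0_pos (aleph0_le_aleph δ)
    · have : {x | G (rk x) (τ x) (hτc x) ⟨x, rfl⟩ = i ∧ f i x = r} = ∅ := by
        ext x
        simp only [Set.mem_ofPred_eq, Set.mem_empty_iff_false, iff_false]
        exact fun h => hemp ⟨x, h⟩
      rw [this]
      simpa using lt_of_lt_of_le aleph0_pos (aleph0_le_aleph δ)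

theorem geom {d : ℕ} (hd : 2 ≤ d) {N : ℕ} (c : Fin N → EuclideanSpace ℝ (Fin d))
    (hc : ∀ s : Finset (Fin N), s.card ≤ d → AffineIndependent ℝ (fun i : s => c i)) :
    FinProp (fun (i : Fin N) (x : EuclideanSpace ℝ (Fin d)) => ‖x - c i‖) (d - 1) := by
  intro T hT v
  have hT' : T.card = d := by omega
  have hind := hc T hT'.le
  have hfr := hind.finrank_vectorSpan (n := d - 1) (by simp [hT])
  set K := vectorSpan ℝ (Set.range fun i : T => c i) with hK
  have horth := Submodule.finrank_add_finrank_orthogonal K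
  rw [hfr, finrank_euclideanSpace_fin] at horth
  have h1 : Module.finrank ℝ Kᗮ = 1 := by omega
  obtain ⟨u, hu0, hu⟩ := finrank_eq_one_iff'.1 h1
  have hu0' : (u : EuclideanSpace ℝ (Fin d)) ≠ 0 := by simpa using hu0
  have hTne : T.Nonempty := by rw [← Finset.card_pos]; omega
  obtain ⟨i0, hi0⟩ := hTne
  rcases Set.eq_empty_or_nonempty {x : EuclideanSpace ℝ (Fin d) | ∀ i ∈ T, ‖x - c i‖ = v i}
    with h | ⟨x0, hx0⟩
  · rw [h]; exact Set.finite_empty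
  refine Set.Finite.subset (Set.toFinite {x0, x0 + (-2 * inner ℝ (x0 - c i0)
    (u : EuclideanSpace ℝ (Fin d)) / ‖(u : EuclideanSpace ℝ (Fin d))‖ ^ 2) •
      (u : EuclideanSpace ℝ (Fin d))}) ?_
  intro x hx
  have heq : ∀ i ∈ T, ‖x - c i‖ = ‖x0 - c i‖ := fun i hi => (hx i hi).trans (hx0 i hi).symm
  have hspan : affineSpan ℝ (Set.range fun i : T => c i) ≤ AffineSubspace.perpBisector x0 x := by
    rw [affineSpan_le]
    rintro _ ⟨i, rfl⟩
    rw [SetLike.mem_coe, AffineSubspace.mem_perpBisector_iff_dist_eq, dist_comm, dist_eq_norm,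
      dist_comm, dist_eq_norm]
    exact (heq i i.2).symm
  have hdir := AffineSubspace.direction_le hspan
  rw [direction_affineSpan, AffineSubspace.direction_perpBisector] at hdir
  have hmem : x - x0 ∈ Kᗮ := by
    have := Submodule.orthogonal_le hdir
    apply this
    exact Submodule.le_orthogonal_orthogonal _ (Submodule.mem_span_singleton_self _)
  obtain ⟨t, ht⟩ := hu ⟨x - x0, hmem⟩
  have ht' : t • (u : EuclideanSpace ℝ (Fin d)) = x - x0 := congrArg Subtype.val ht
  have hxe : x = x0 + t • (u : EuclideanSpace ℝ (Fin d)) := by rw [ht']; abel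
  have hn := heq i0 hi0
  rw [hxe, add_sub_right_comm] at hn
  have hsq := norm_add_sq_real (x0 - c i0) (t • (u : EuclideanSpace ℝ (Fin d)))
  rw [hn, inner_smul_right, norm_smul, mul_pow, Real.norm_eq_abs, sq_abs] at hsq
  have hun : ‖(u : EuclideanSpace ℝ (Fin d))‖ ^ 2 ≠ 0 := by simpa using hu0'
  have hprod : t * (2 * inner ℝ (x0 - c i0) (u : EuclideanSpace ℝ (Fin d))
      + t * ‖(u : EuclideanSpace ℝ (Fin d))‖ ^ 2) = 0 := by linarith
  rcases mul_eq_zero.1 hprod with h | h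
  · left
    rw [hxe, h]; simp
  · right
    rw [Set.mem_singleton_iff]
    rw [hxe]
    congr 2
    rw [eq_div_iff hun]
    linarith

theorem stmt8 (d n δ : ℕ) (hd : 2 ≤ d) (hδ : δ ≤ 1)
    (c : Fin ((n + 1) * (d - 1) + 1) → EuclideanSpace ℝ (Fin d))
    (hc : WellPlaced c)
    (hCH : continuum ≤ aleph ((δ : Ordinal) + n)) :
    ∃ X : Fin ((n + 1) * (d - 1) + 1) → Set (EuclideanSpace ℝ (Fin d)),
      (⋃ i, X i) = Set.univ ∧ ∀ i, IsAlephSpray δ (c i) (X i) := by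
  have hP : #(EuclideanSpace ℝ (Fin d)) ≤ aleph ((δ : Ordinal) + n) := by
    have hCH0 : continuum.{0} ≤ aleph ((δ : Ordinal.{0}) + n) := by
      rw [← lift_continuum.{_, 0}, ← lift_le.{0}] at hCH
      rw [← lift_le.{u_1}]
      simpa using hCH
    refine le_trans ?_ hCH0
    rw [(WithLp.equiv 2 (Fin d → ℝ)).cardinal_eq, ← power_def, mk_real, mk_fin]
    exact power_nat_le aleph0_le_continuum
  obtain ⟨g, -, hg⟩ := spray_main (d - 1) (δ : Ordinal) n _ _ (geom hd c hc.2) hP Finset.univ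
    (by simp)
  refine ⟨fun i => {x | g x = i}, ?_, fun i r => hg i r⟩
  ext x
  simp
end

section
/- Let d ≥ 2 and let (c_n)_{n ≥ 1} be a sequence of distinct points of ℝ^d that all lie on a common affine hyperplane H and are in general position in H (every subset of them of size ≤ d is affinely independent). Then there are sets X_n (n ≥ 1) covering ℝ^d such that each X_n is a drizzle with center c_n. -/
/-- A drizzle with center `c`: every sphere centered at `c` meets `X` in at most one point. -/
def IsDrizzle {d : ℕ} (c : EuclideanSpace ℝ (Fin d)) (X : Set (EuclideanSpace ℝ (Fin d))) : Prop :=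
  ∀ r : ℝ, {x ∈ X | ‖x - c‖ = r}.Subsingleton

/-- One closure step. -/
def drzStep {V : Type} (D : ℕ → V → ℝ) (d : ℕ) (S : Set V) : Set V :=
  S ∪ ⋃ p : {n : Fin d → ℕ // Function.Injective n} × (Fin d → S),
    {x | ∀ i, D (p.1.1 i) x = D (p.1.1 i) (p.2 i)}

/-- Closure. -/
def drzCl {V : Type} (D : ℕ → V → ℝ) (d : ℕ) (S : Set V) : Set V :=
  ⋃ k : ℕ, (drzStep D d)^[k] S

open Cardinal in
theorem drzStep_card {V : Type} (D : ℕ → V → ℝ) (d : ℕ)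
    (hfib : ∀ n : Fin d → ℕ, Function.Injective n → ∀ r : Fin d → ℝ,
      {x | ∀ i, D (n i) x = r i}.Countable) (S : Set V) (κ : Cardinal) (hκ : ℵ₀ ≤ κ)
    (hS : #S ≤ κ) : #(drzStep D d S) ≤ κ := by
  unfold drzStep
  refine (mk_union_le _ _).trans (add_le_of_le hκ hS ?_)
  refine (mk_iUnion_le _).trans (mul_le_of_le hκ ?_ ?_)
  · rw [mk_prod, lift_id, lift_id]
    refine mul_le_of_le hκ ((mk_le_aleph0).trans hκ) ?_
    rw [← power_def, mk_fin]
    exact (power_le_power_right hS).trans (power_nat_le hκ)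
  · refine ciSup_le' fun p => ?_
    exact (le_aleph0_iff_set_countable.2 (hfib p.1.1 p.1.2 _)).trans hκ

open Cardinal in
theorem drzCl_card {V : Type} (D : ℕ → V → ℝ) (d : ℕ)
    (hfib : ∀ n : Fin d → ℕ, Function.Injective n → ∀ r : Fin d → ℝ,
      {x | ∀ i, D (n i) x = r i}.Countable) (S : Set V) (κ : Cardinal) (hκ : ℵ₀ ≤ κ)
    (hS : #S ≤ κ) : #(drzCl D d S) ≤ κ := by
  unfold drzCl
  refine (mk_iUnion_le _).trans (mul_le_of_le hκ (by simpa using hκ) ?_)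
  refine ciSup_le' fun k => ?_
  induction k with
  | zero => simpa using hS
  | succ k ih =>
    rw [Function.iterate_succ_apply']
    exact drzStep_card D d hfib _ κ hκ ih

theorem drzStep_mono {V : Type} (D : ℕ → V → ℝ) (d : ℕ) {S T : Set V} (h : S ⊆ T) :
    drzStep D d S ⊆ drzStep D d T := by
  rintro x (hx | hx)
  · exact Or.inl (h hx)
  · right
    simp only [Set.mem_iUnion, Set.mem_ofPred_eq] at hx ⊢
    obtain ⟨p, hp⟩ := hx
    exact ⟨⟨p.1, fun i => ⟨p.2 i, h (p.2 i).2⟩⟩, hp⟩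

theorem drzCl_mono {V : Type} (D : ℕ → V → ℝ) (d : ℕ) {S T : Set V} (h : S ⊆ T) :
    drzCl D d S ⊆ drzCl D d T := by
  refine Set.iUnion_mono fun k => ?_
  induction k with
  | zero => simpa using h
  | succ k ih =>
    rw [Function.iterate_succ_apply', Function.iterate_succ_apply']
    exact drzStep_mono D d ih

theorem subset_drzCl {V : Type} (D : ℕ → V → ℝ) (d : ℕ) (S : Set V) : S ⊆ drzCl D d S :=
  fun _ hx => Set.mem_iUnion.2 ⟨0, hx⟩

theorem drzCl_closed {V : Type} (D : ℕ → V → ℝ) (d : ℕ) (S : Set V)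
    (n : Fin d → ℕ) (hn : Function.Injective n) (y : Fin d → V) (hy : ∀ i, y i ∈ drzCl D d S)
    (x : V) (hx : ∀ i, D (n i) x = D (n i) (y i)) : x ∈ drzCl D d S := by
  have hmono : Monotone fun k => (drzStep D d)^[k] S := by
    refine monotone_nat_of_le_succ fun k => ?_
    rw [Function.iterate_succ_apply']
    exact Set.subset_union_left
  simp only [drzCl, Set.mem_iUnion] at hy
  choose k hk using hy
  obtain ⟨K, hK⟩ := (Set.finite_range k).bddAbove
  have hk' : ∀ i, y i ∈ (drzStep D d)^[K] S := fun i => hmono (hK ⟨i, rfl⟩) (hk i)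
  refine Set.mem_iUnion.2 ⟨K + 1, ?_⟩
  rw [Function.iterate_succ_apply']
  right
  exact Set.mem_iUnion.2 ⟨⟨⟨n, hn⟩, fun i => ⟨y i, hk' i⟩⟩, hx⟩

open Cardinal in
theorem drz_color {V : Type} (D : ℕ → V → ℝ) (d : ℕ)
    (hfib : ∀ n : Fin d → ℕ, Function.Injective n → ∀ r : Fin d → ℝ,
      {x | ∀ i, D (n i) x = r i}.Countable) (κ : Cardinal) :
    ∀ A : Set V, #A = κ → ∀ B : V → Set ℕ, (∀ x, (B x).Finite) →
      ∃ f : V → ℕ, ∀ x ∈ A, f x ∉ B x ∧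
        ∀ y ∈ A, f x = f y → D (f x) x = D (f x) y → x = y := by
  classical
  induction κ using WellFoundedLT.induction with
  | ind κ ih =>
  intro A hA B hB
  rcases le_or_gt κ ℵ₀ with hκ | hκ
  · have hc : A.Countable := by rw [← le_aleph0_iff_set_countable, hA]; exact hκ
    obtain ⟨e, he⟩ := Set.countable_iff_exists_injOn.1 hc
    have : ∀ x, ∃ m, Nat.pair (e x) m ∉ B x := by
      intro x
      have hinj : Function.Injective (Nat.pair (e x)) := fun a b h => by
        simpa using (Nat.pair_eq_pair.1 h).2
      exact ((hB x).preimage hinj.injOn).exists_notMem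
    choose m hm using this
    refine ⟨fun x => Nat.pair (e x) (m x), fun x hx => ⟨hm x, fun y hy h _ => ?_⟩⟩
    exact he hx hy (Nat.pair_eq_pair.1 h).1
  · have hI : #κ.ord.ToType = κ := mk_ord_toType κ
    obtain ⟨e⟩ : Nonempty (A ≃ κ.ord.ToType) := Cardinal.eq.1 (by rw [hA, hI])
    let T : κ.ord.ToType → Set V := fun i => drzCl D d (Set.range fun j : Set.Iic i => (e.symm j : V))
    have hT : ∀ i, #(T i) < κ := by
      intro i
      have h1 : #(Set.Iic i) < κ := by
        have : Infinite κ.ord.ToType := by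
          rw [infinite_iff, hI]; exact hκ.le
        have := mk_Iic_lt i (by simp)
        rw [hI] at this
        exact this hκ.le
      refine lt_of_le_of_lt (drzCl_card D d hfib _ (max ℵ₀ #(Set.Iic i)) (le_max_left _ _)
        (mk_range_le.trans (le_max_right _ _))) (max_lt hκ h1)
    have hTmono : Monotone T := by
      intro i j hij
      refine drzCl_mono D d ?_
      rintro _ ⟨k, rfl⟩
      exact ⟨⟨k, k.2.trans hij⟩, rfl⟩
    have hAT : ∀ x : A, (x : V) ∈ T (e x) := fun x =>
      subset_drzCl D d _ ⟨⟨e x, Set.mem_Iic.2 le_rfl⟩, by simp⟩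
    have hrk : ∀ x : A, ∃ i, (x : V) ∈ T i ∧ ∀ j, j < i → (x : V) ∉ T j := by
      intro x
      have hw : WellFounded ((· < ·) : κ.ord.ToType → κ.ord.ToType → Prop) := wellFounded_lt
      refine ⟨hw.min {i | (x : V) ∈ T i} ⟨_, hAT x⟩, hw.min_mem {i | (x : V) ∈ T i} ⟨_, hAT x⟩, fun j hj hx => ?_⟩
      exact hw.not_lt_min {i | (x : V) ∈ T i} hx hj
    choose rk hrk1 hrk2 using hrk
    let bad : V → Set ℕ := fun x =>
      {n | ∃ hx : x ∈ A, ∃ y : A, rk y < rk ⟨x, hx⟩ ∧ D n x = D n y}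
    have hbad : ∀ x, (bad x).Finite := by
      intro x
      by_contra hinf
      have hinf : (bad x).Infinite := hinf
      have : Infinite (bad x) := hinf.to_subtype
      let n : Fin d → bad x := fun i => Infinite.natEmbedding (bad x) i
      have hn : Function.Injective fun i => (n i : ℕ) := by
        intro i j h
        have := (Infinite.natEmbedding (bad x)).injective (Subtype.ext h)
        exact Fin.ext this
      obtain ⟨hx, y0, hy0, -⟩ := hinf.nonempty.choose_spec
      have hy : ∀ i, ∃ y : A, rk y < rk ⟨x, hx⟩ ∧ D (n i) x = D (n i) y := fun i => by
        obtain ⟨_, h⟩ := (n i).2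
        exact h
      choose y hy1 hy2 using hy
      obtain ⟨b, hb, hyb⟩ : ∃ b, b < rk ⟨x, hx⟩ ∧ ∀ i, rk (y i) ≤ b := by
        let s : Finset κ.ord.ToType := insert (rk y0) (Finset.univ.image fun i => rk (y i))
        have hs : s.Nonempty := ⟨_, Finset.mem_insert_self _ _⟩
        refine ⟨s.max' hs, ?_, fun i => Finset.le_max' _ _ ?_⟩
        · rw [Finset.max'_lt_iff]
          intro z hz
          simp only [s, Finset.mem_insert, Finset.mem_image, Finset.mem_univ, true_and] at hz
          rcases hz with rfl | ⟨i, rfl⟩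
          · exact hy0
          · exact hy1 i
        · simp [s]
      exact hrk2 ⟨x, hx⟩ b hb (drzCl_closed D d _ _ hn (fun i => (y i : V))
        (fun i => hTmono (hyb i) (hrk1 (y i))) x hy2)
    have hcol : ∀ i, ∃ f : V → ℕ, ∀ x ∈ A ∩ T i, f x ∉ B x ∪ bad x ∧
        ∀ y ∈ A ∩ T i, f x = f y → D (f x) x = D (f x) y → x = y := fun i =>
      ih #(A ∩ T i : Set V) ((mk_le_mk_of_subset Set.inter_subset_right).trans_lt (hT i)) _ rfl
        (fun x => B x ∪ bad x) (fun x => (hB x).union (hbad x))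
    choose f hf using hcol
    refine ⟨fun x => if hx : x ∈ A then f (rk ⟨x, hx⟩) x else 0, fun x hx => ?_⟩
    have hx' := hf (rk ⟨x, hx⟩) x ⟨hx, hrk1 ⟨x, hx⟩⟩
    simp only [hx, dif_pos]
    refine ⟨fun h => hx'.1 (Or.inl h), fun y hy => ?_⟩
    have hy' := hf (rk ⟨y, hy⟩) y ⟨hy, hrk1 ⟨y, hy⟩⟩
    simp only [hy, dif_pos]
    intro h1 h2
    rcases lt_trichotomy (rk ⟨x, hx⟩) (rk ⟨y, hy⟩) with h | h | h
    · exact absurd (Or.inr ⟨hy, ⟨x, hx⟩, h, by rw [← h1]; exact h2.symm⟩) hy'.1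
    · refine hx'.2 y ⟨hy, h ▸ hrk1 ⟨y, hy⟩⟩ ?_ h2
      rw [h1, h]
    · exact absurd (Or.inr ⟨hx, ⟨y, hy⟩, h, h2⟩) hx'.1

theorem drz_fib (d : ℕ) (hd : 2 ≤ d) (p : Fin d → EuclideanSpace ℝ (Fin d))
    (hp : AffineIndependent ℝ p) (r : Fin d → ℝ) : {x | ∀ i, ‖x - p i‖ = r i}.Countable := by
  rcases Set.eq_empty_or_nonempty {x | ∀ i, ‖x - p i‖ = r i} with h | ⟨x0, hx0⟩
  · rw [h]; exact Set.countable_empty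
  let i0 : Fin d := ⟨0, by omega⟩
  have hW : Module.finrank ℝ (vectorSpan ℝ (Set.range p)) = d - 1 :=
    hp.finrank_vectorSpan (by simp; omega)
  have hW1 : Module.finrank ℝ (vectorSpan ℝ (Set.range p))ᗮ = 1 := by
    have := Submodule.finrank_add_finrank_orthogonal (vectorSpan ℝ (Set.range p))
    rw [hW, finrank_euclideanSpace, Fintype.card_fin] at this
    omega
  obtain ⟨v, hv0, hv⟩ := finrank_eq_one_iff'.1 hW1
  have hv0' : ‖(v : EuclideanSpace ℝ (Fin d))‖ ≠ 0 := by simpa using hv0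
  have key : {x | ∀ i, ‖x - p i‖ = r i} ⊆ (fun t : ℝ => x0 + t • (v : EuclideanSpace ℝ (Fin d))) ''
      {0, -2 * inner ℝ (x0 - p i0) (v : EuclideanSpace ℝ (Fin d)) / ‖(v : EuclideanSpace ℝ (Fin d))‖ ^ 2} := by
    intro x hx
    have hmem : x - x0 ∈ (vectorSpan ℝ (Set.range p))ᗮ := by
      rw [vectorSpan_range_eq_span_range_vsub_right ℝ p i0, Submodule.mem_orthogonal]
      intro u hu
      induction hu using Submodule.span_induction with
      | mem u hu =>
        obtain ⟨i, rfl⟩ := hu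
        have e (j) : ‖x - p j‖ ^ 2 = ‖x0 - p j‖ ^ 2 := by rw [hx j, hx0 j]
        have e1 := e i
        have e2 := e i0
        rw [norm_sub_sq_real, norm_sub_sq_real] at e1 e2
        simp only [vsub_eq_sub, inner_sub_left, inner_sub_right]
        rw [real_inner_comm x, real_inner_comm x0, real_inner_comm x, real_inner_comm x0]
        linarith
      | zero => simp
      | add a b _ _ ha hb => rw [inner_add_left, ha, hb, add_zero]
      | smul a b _ hb => rw [inner_smul_left, hb, mul_zero]
    obtain ⟨t, ht⟩ := hv ⟨_, hmem⟩
    have ht : t • (v : EuclideanSpace ℝ (Fin d)) = x - x0 := congrArg Subtype.val ht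
    refine ⟨t, ?_, by simp [ht]⟩
    have e : ‖(x0 - p i0) + t • (v : EuclideanSpace ℝ (Fin d))‖ ^ 2 = ‖x0 - p i0‖ ^ 2 := by
      rw [ht, hx0 i0, ← hx i0]; congr 2; abel
    rw [norm_add_sq_real, inner_smul_right, norm_smul, mul_pow, Real.norm_eq_abs, sq_abs] at e
    by_cases h0 : t = 0
    · left; exact h0
    · right
      rw [Set.mem_singleton_iff, eq_div_iff (pow_ne_zero 2 hv0')]
      apply mul_left_cancel₀ h0
      linarith
  exact (((Set.finite_singleton _).insert _).image _ |>.subset key).countable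

theorem stmt9 (d : ℕ) (hd : 2 ≤ d) (c : ℕ → EuclideanSpace ℝ (Fin d))
    (hinj : Function.Injective c)
    (H : AffineSubspace ℝ (EuclideanSpace ℝ (Fin d)))
    (hH : Module.finrank ℝ H.direction = d - 1)
    (hcH : ∀ n, c n ∈ H)
    (hgen : ∀ s : Finset ℕ, s.card ≤ d → AffineIndependent ℝ (fun i : s => c i)) :
    ∃ X : ℕ → Set (EuclideanSpace ℝ (Fin d)),
      (⋃ n, X n) = Set.univ ∧ ∀ n, IsDrizzle (c n) (X n) := by
  classical
  have hfib : ∀ n : Fin d → ℕ, Function.Injective n → ∀ r : Fin d → ℝ,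
      {x | ∀ i, (fun m x => ‖x - c m‖) (n i) x = r i}.Countable := by
    intro n hn r
    refine drz_fib d hd (fun i => c (n i)) ?_ r
    have h := hgen (Finset.univ.image n) (Finset.card_image_le.trans (by simp))
    exact h.comp_embedding ⟨fun i : Fin d => (⟨n i, by simp⟩ : Finset.univ.image n),
      fun i j hij => hn (congrArg Subtype.val hij)⟩
  obtain ⟨f, hf⟩ := drz_color (fun m x => ‖x - c m‖) d hfib _ Set.univ rfl (fun _ => ∅)
    (fun _ => Set.finite_empty)
  refine ⟨fun n => {x | f x = n}, ?_, ?_⟩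
  · ext x; simp
  · rintro n r x ⟨hx, hxr⟩ y ⟨hy, hyr⟩
    have hx : f x = n := hx
    have hy : f y = n := hy
    refine (hf x trivial).2 y trivial (hx.trans hy.symm) ?_
    simp only [hx, hxr, hyr]
end
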